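/- Let x, y ∈ {0,1}^n and z = x ∧ y (bitwise AND). With U_{i,σ} and V_{i,σ} as defined, for any vector |φ⟩ = Σ_{i=1}^n α_i|i⟩: (U_{n,x_n}···U_{1,x_1}) ∘ (V_{n,y_n}···V_{1,y_1}) ∘ (U_{n,x_n}···U_{1,x_1}) applied to |φ⟩|0⟩ equals Σ_{i=1}^n (-1)^{z_i} α_i |i⟩|0⟩ = (O_z|φ⟩)|0⟩. -/

import Mathlib

/-- The controlled bit-flip `U_{i,σ}`: `U_{i,σ}|j⟩|b⟩ = |j⟩|b ⊕ σ⟩` if `j = i`, identity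
otherwise. -/
def Uop {n : ℕ} (i : Fin n) (σ : Bool) : (Fin n × Bool → ℂ) → (Fin n × Bool → ℂ) :=
  fun v p => v (p.1, if p.1 = i then xor p.2 σ else p.2)

/-- The controlled phase `V_{i,σ}`: `V_{i,σ}|i⟩|1⟩ = (-1)^σ|i⟩|1⟩`, identity on all other
basis states. -/
def Vop {n : ℕ} (i : Fin n) (σ : Bool) : (Fin n × Bool → ℂ) → (Fin n × Bool → ℂ) :=
  fun v p => (if p.1 = i ∧ p.2 = true then (if σ then (-1 : ℂ) else 1) else 1) * v p

/-- The composition `U_{n,x_n} ∘ ⋯ ∘ U_{1,x_1}` (applying `U_{1,x_1}` first). -/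
def Uchain {n : ℕ} (x : Fin n → Bool) : (Fin n × Bool → ℂ) → (Fin n × Bool → ℂ) :=
  (List.ofFn (fun i : Fin n => Uop i (x i))).foldl (fun acc d => d ∘ acc) id

/-- The composition `V_{n,y_n} ∘ ⋯ ∘ V_{1,y_1}` (applying `V_{1,y_1}` first). -/
def Vchain {n : ℕ} (y : Fin n → Bool) : (Fin n × Bool → ℂ) → (Fin n × Bool → ℂ) :=
  (List.ofFn (fun i : Fin n => Vop i (y i))).foldl (fun acc d => d ∘ acc) id

/-- Composing the `Uop i (x i)` along a duplicate-free list flips exactly the fibres listed. -/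
theorem foldl_Uop_apply {n : ℕ} (x : Fin n → Bool) (l : List (Fin n)) (hl : l.Nodup)
    (acc : (Fin n × Bool → ℂ) → (Fin n × Bool → ℂ)) (v : Fin n × Bool → ℂ) (p : Fin n × Bool) :
    (l.map fun i => Uop i (x i)).foldl (fun acc d => d ∘ acc) acc v p =
      acc v (p.1, if p.1 ∈ l then xor p.2 (x p.1) else p.2) := by
  induction l generalizing acc with
  | nil => simp
  | cons i l ih =>
    obtain ⟨hi, hl⟩ := List.nodup_cons.mp hl
    rw [List.map_cons, List.foldl_cons, ih hl]
    by_cases h : p.1 = i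
    · simp [Uop, h, hi]
    · simp [Uop, h]

/-- Composing the `Vop i (y i)` along a duplicate-free list applies the phases listed. -/
theorem foldl_Vop_apply {n : ℕ} (y : Fin n → Bool) (l : List (Fin n)) (hl : l.Nodup)
    (acc : (Fin n × Bool → ℂ) → (Fin n × Bool → ℂ)) (v : Fin n × Bool → ℂ) (p : Fin n × Bool) :
    (l.map fun i => Vop i (y i)).foldl (fun acc d => d ∘ acc) acc v p =
      (if p.1 ∈ l ∧ p.2 = true then (if y p.1 then (-1 : ℂ) else 1) else 1) * acc v p := by
  induction l generalizing acc with
  | nil => simp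
  | cons i l ih =>
    obtain ⟨hi, hl⟩ := List.nodup_cons.mp hl
    rw [List.map_cons, List.foldl_cons, ih hl]
    by_cases h : p.1 = i
    · simp [Vop, h, hi]
    · simp [Vop, h]

theorem Uchain_apply {n : ℕ} (x : Fin n → Bool) (v : Fin n × Bool → ℂ) (p : Fin n × Bool) :
    Uchain x v p = v (p.1, xor p.2 (x p.1)) := by
  rw [Uchain, List.ofFn_eq_map, foldl_Uop_apply x _ (List.nodup_finRange n)]
  simp

theorem Vchain_apply {n : ℕ} (y : Fin n → Bool) (v : Fin n × Bool → ℂ) (p : Fin n × Bool) :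
    Vchain y v p = (if p.2 = true then (if y p.1 then (-1 : ℂ) else 1) else 1) * v p := by
  rw [Vchain, List.ofFn_eq_map, foldl_Vop_apply y _ (List.nodup_finRange n)]
  simp

/-- With `z = x ∧ y` bitwise, `(U_{n,x_n}⋯U_{1,x_1}) ∘ (V_{n,y_n}⋯V_{1,y_1}) ∘
(U_{n,x_n}⋯U_{1,x_1})` sends `Σ αᵢ|i⟩|0⟩` to `Σ (-1)^{zᵢ} αᵢ|i⟩|0⟩ = (O_z|φ⟩)|0⟩`. -/
theorem stmt_11 (n : ℕ) (x y : Fin n → Bool) (α : Fin n → ℂ) :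
    (Uchain x ∘ Vchain y ∘ Uchain x) (fun p => if p.2 = false then α p.1 else 0) =
      fun p => if p.2 = false then (if x p.1 && y p.1 then (-1 : ℂ) else 1) * α p.1 else 0 := by
  funext ⟨i, b⟩
  simp only [Function.comp_apply, Uchain_apply, Vchain_apply]
  cases b <;> cases x i <;> simp
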